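/- arXiv:2306.10838 — 3 statements merged into one kernel-verified Lean document; each statement's English description precedes it below -/
import Mathlib

section
/- Let m ≥ 1 and λ : ℤ →₀ ZMod m. Then the following are equivalent: (1) S_λ is surjective; (2) S_λ is bijective; (3) S_λ is bijective and its inverse equals S_μ for some μ : ℤ →₀ ZMod m; (4) for every prime p dividing m there is exactly one i ∈ ℤ such that the image of λ(i) under the natural ring homomorphism ZMod m → ZMod p is nonzero. -/
/-- The one-dimensional finitary linear cellular automaton `S_lam` on `ZZ ->0 ZMod m`:
`(S_lam a) n = sum_i lam i * a (n + i)`. -/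
noncomputable def SCA (m : ℕ) (lam : ℤ →₀ ZMod m) (a : ℤ →₀ ZMod m) : ℤ →₀ ZMod m :=
  lam.sum fun i c => c • Finsupp.equivMapDomain (Equiv.subRight i) a

/-- The Laurent polynomial attached to a rule. -/
noncomputable def PL {m : ℕ} (lam : ℤ →₀ ZMod m) : LaurentPolynomial (ZMod m) :=
  lam.sum fun i c => AddMonoidAlgebra.single (-i) c

lemma PL_coeff {m : ℕ} (lam : ℤ →₀ ZMod m) (n : ℤ) : (PL lam).coeff n = lam (-n) := by
  classical
  unfold PL
  rw [AddMonoidAlgebra.coeff_finsuppSum, Finsupp.sum_apply, Finsupp.sum, Finset.sum_eq_single (-n)]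
  · rw [AddMonoidAlgebra.coeff_single, neg_neg, Finsupp.single_eq_same]
  · intro b _ hb
    rw [AddMonoidAlgebra.coeff_single, Finsupp.single_apply, if_neg]
    intro h; apply hb; omega
  · intro h; simp at h; simp [h]

lemma PL_surj {m : ℕ} (b : LaurentPolynomial (ZMod m)) : ∃ mu : ℤ →₀ ZMod m, PL mu = b := by
  refine ⟨Finsupp.equivMapDomain (Equiv.neg ℤ) b.coeff, ?_⟩
  apply LaurentPolynomial.ext
  intro n
  rw [PL_coeff]
  simp [Finsupp.equivMapDomain_apply]

lemma SCA_eq {m : ℕ} (lam a : ℤ →₀ ZMod m) :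
    AddMonoidAlgebra.ofCoeff (SCA m lam a) = PL lam * AddMonoidAlgebra.ofCoeff a := by
  unfold SCA PL
  rw [AddMonoidAlgebra.ofCoeff_finsuppSum, Finsupp.sum, Finsupp.sum, Finset.sum_mul]
  refine Finset.sum_congr rfl fun i _ => ?_
  apply LaurentPolynomial.ext
  intro n
  rw [AddMonoidAlgebra.coeff_single_mul_eq_mul_coeff (n + i)]
  · simp [Finsupp.equivMapDomain_apply]
  · intro x _
    constructor <;> intro h <;> omega

lemma unit_dom {R : Type*} [CommRing R] [IsDomain R] (f g : LaurentPolynomial R) (h : f * g = 1) :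
    ∃! i : ℤ, f.coeff i ≠ 0 := by
  classical
  have hf : f ≠ 0 := by rintro rfl; simp at h
  have hg : g ≠ 0 := by rintro rfl; simp at h
  have key : ∀ a ∈ f.coeff.support, ∀ b ∈ g.coeff.support,
      UniqueAdd f.coeff.support g.coeff.support a b → a + b = 0 := by
    intro a ha b hb hu
    by_contra hne
    have h1 := AddMonoidAlgebra.coeff_mul_add_of_uniqueAdd hu
    rw [h, AddMonoidAlgebra.one_def, AddMonoidAlgebra.coeff_single, Finsupp.single_apply,
      if_neg (Ne.symm hne)] at h1
    exact mul_ne_zero (Finsupp.mem_support_iff.1 ha) (Finsupp.mem_support_iff.1 hb) h1.symm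
  have hfc : 0 < f.coeff.support.card := by
    rw [Finset.card_pos, Finsupp.support_nonempty_iff]; simpa using hf
  have hgc : 0 < g.coeff.support.card := by
    rw [Finset.card_pos, Finsupp.support_nonempty_iff]; simpa using hg
  have hc : ¬ 1 < f.coeff.support.card * g.coeff.support.card := by
    intro hc
    obtain ⟨p, hp, q, hq, hpq, up, uq⟩ := TwoUniqueSums.uniqueAdd_of_one_lt_card hc
    rw [Finset.mem_product] at hp hq
    have e1 := key _ hp.1 _ hp.2 up
    have e2 := key _ hq.1 _ hq.2 uq
    have := up hq.1 hq.2 (e2.trans e1.symm)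
    exact hpq (Prod.ext this.1.symm this.2.symm)
  have h1 : f.coeff.support.card = 1 := by nlinarith
  obtain ⟨i, hi⟩ := Finset.card_eq_one.1 h1
  refine ⟨i, ?_, ?_⟩
  · change f.coeff i ≠ 0
    rw [← Finsupp.mem_support_iff, hi]; simp
  · intro j hj
    change f.coeff j ≠ 0 at hj
    rw [← Finsupp.mem_support_iff, hi] at hj
    simpa using hj

lemma unit_of_four {m : ℕ} (hm : 1 ≤ m) (lam : ℤ →₀ ZMod m)
    (h : ∀ p : ℕ, p.Prime → ∀ hd : p ∣ m,
         ∃! i : ℤ, ZMod.castHom hd (ZMod p) (lam i) ≠ 0) : IsUnit (PL lam) := by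
  by_contra hu
  obtain ⟨M, hM, hmem⟩ := exists_max_ideal_of_mem_nonunits hu
  let K := LaurentPolynomial (ZMod m) ⧸ M
  letI : Field K := Ideal.Quotient.field M
  let φ : LaurentPolynomial (ZMod m) →+* K := Ideal.Quotient.mk M
  have h0 : φ (PL lam) = 0 := Ideal.Quotient.eq_zero_iff_mem.2 hmem
  obtain ⟨p, hp⟩ := CharP.exists K
  have hm0 : (m : K) = 0 := by
    have : ((m : ZMod m) : ZMod m) = 0 := ZMod.natCast_self m
    have := congrArg (φ.comp LaurentPolynomial.C) this
    rwa [map_natCast, map_zero] at this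
  have hd : p ∣ m := (CharP.cast_eq_zero_iff K p m).1 hm0
  have hpp : p.Prime := by
    rcases CharP.char_is_prime_or_zero K p with h | h
    · exact h
    · subst h; rw [zero_dvd_iff] at hd; omega
  obtain ⟨i, hi, hiu⟩ := h p hpp hd
  haveI : Fact p.Prime := ⟨hpp⟩
  let ψ : ZMod p →+* K := ZMod.castHom (dvd_refl p) K
  have hcomp : φ.comp LaurentPolynomial.C = ψ.comp (ZMod.castHom hd (ZMod p)) :=
    RingHom.ext_zmod _ _
  have hs : ∀ j c, φ (AddMonoidAlgebra.single j c) =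
      ψ (ZMod.castHom hd (ZMod p) c) * φ (LaurentPolynomial.T j) := by
    intro j c
    rw [LaurentPolynomial.single_eq_C_mul_T, map_mul]
    congr 1
    exact congrArg (fun F : ZMod m →+* K => F c) hcomp
  have hsum : φ (PL lam) = φ (AddMonoidAlgebra.single (-i) (lam i)) := by
    unfold PL
    rw [Finsupp.sum, map_sum, Finset.sum_eq_single i]
    · intro j _ hj
      rw [hs]
      have : ZMod.castHom hd (ZMod p) (lam j) = 0 := by
        by_contra hne; exact hj (hiu j hne)
      rw [this, map_zero, zero_mul]
    · intro hn
      rw [Finsupp.notMem_support_iff.1 hn]; simp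
  rw [hsum, hs] at h0
  rcases mul_eq_zero.1 h0 with h1 | h1
  · exact hi ((map_eq_zero ψ).1 h1)
  · exact ((LaurentPolynomial.isUnit_T (R := ZMod m) (-i)).map φ).ne_zero h1

lemma three_of_mul {m : ℕ} (lam : ℤ →₀ ZMod m) (b : LaurentPolynomial (ZMod m))
    (hb : PL lam * b = 1) : Function.Bijective (SCA m lam) ∧
         ∃ mu : ℤ →₀ ZMod m,
           Function.LeftInverse (SCA m mu) (SCA m lam) ∧
           Function.RightInverse (SCA m mu) (SCA m lam) := by
  obtain ⟨mu, rfl⟩ := PL_surj b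
  have hl : Function.LeftInverse (SCA m mu) (SCA m lam) := by
    intro a
    apply AddMonoidAlgebra.ofCoeff_injective
    rw [SCA_eq, SCA_eq, ← mul_assoc, mul_comm (PL mu), hb, one_mul]
  have hr : Function.RightInverse (SCA m mu) (SCA m lam) := by
    intro a
    apply AddMonoidAlgebra.ofCoeff_injective
    rw [SCA_eq, SCA_eq, ← mul_assoc, hb, one_mul]
  exact ⟨⟨hl.injective, hr.surjective⟩, mu, hl, hr⟩

theorem stmt9 (m : ℕ) (hm : 1 ≤ m) (lam : ℤ →₀ ZMod m) :
    List.TFAE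
      [Function.Surjective (SCA m lam),
       Function.Bijective (SCA m lam),
       Function.Bijective (SCA m lam) ∧
         ∃ mu : ℤ →₀ ZMod m,
           Function.LeftInverse (SCA m mu) (SCA m lam) ∧
           Function.RightInverse (SCA m mu) (SCA m lam),
       ∀ p : ℕ, p.Prime → ∀ hd : p ∣ m,
         ∃! i : ℤ, ZMod.castHom hd (ZMod p) (lam i) ≠ 0] := by
  tfae_have 3 → 2 := fun h => h.1
  tfae_have 2 → 1 := fun h => h.2
  tfae_have 4 → 3 := by
    intro h
    obtain ⟨b, hb⟩ := (unit_of_four hm lam h).exists_right_inv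
    exact three_of_mul lam b hb
  tfae_have 1 → 4 := by
    intro h p hp hd
    haveI : Fact p.Prime := ⟨hp⟩
    obtain ⟨a, ha⟩ := h (Finsupp.single 0 1)
    have h1 : PL lam * AddMonoidAlgebra.ofCoeff a = 1 := by
      rw [← SCA_eq, ha]; rfl
    have h2 := congrArg (AddMonoidAlgebra.mapRingHom ℤ (ZMod.castHom hd (ZMod p))) h1
    rw [map_mul, map_one] at h2
    obtain ⟨i, hi, hu⟩ := unit_dom _ _ h2
    have hc : ∀ n, (AddMonoidAlgebra.mapRingHom ℤ (ZMod.castHom hd (ZMod p)) (PL lam)).coeff n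
        = ZMod.castHom hd (ZMod p) (lam (-n)) := by
      intro n
      rw [← PL_coeff]; simp
    refine ⟨-i, ?_, ?_⟩
    · have := hi
      simp only [hc] at this
      exact this
    · intro j hj
      have := hu (-j) (by simp only [hc, neg_neg]; exact hj)
      omega
  tfae_finish
end

section
/- Let m ≥ 1 and λ : ℤ →₀ ZMod m be nonzero, with l := min supp(λ) and r := max supp(λ). If r ≤ 0 and λ(l) is a unit of ZMod m, then h_alg(S_λ) = (−l)·log m. -/
open scoped Pointwise in
/-- The `n`-th trajectory of `F` under `phi`: `T_n(phi,F) = F + phi(F) + ... + phi^(n-1)(F)`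
(with `T_0 = {0}`, the empty sum). -/
def Traj {G : Type*} [AddCommGroup G] (φ : G → G) (F : Set G) : ℕ → Set G
  | 0 => {0}
  | n + 1 => Traj φ F n + φ^[n] '' F

/-- The algebraic entropy of an endomorphism of an abelian group: the sup over
nonempty finite subsets `F` of `limsup (log |T_n(phi,F)|) / n`, in extended nonneg. reals. -/
noncomputable def algEntropy {G : Type*} [AddCommGroup G] (φ : G → G) : ENNReal :=
  ⨆ (F : Set G) (_ : F.Finite) (_ : F.Nonempty),
    Filter.atTop.limsup fun n : ℕ =>
      ENNReal.ofReal (Real.log (Nat.card (Traj φ F n)) / n)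

theorem SCA_apply (m : ℕ) (lam a : ℤ →₀ ZMod m) (n : ℤ) :
    SCA m lam a n = ∑ i ∈ lam.support, lam i * a (n + i) := by
  simp [SCA, Finsupp.sum, Finsupp.finsetSum_apply, Finsupp.equivMapDomain_apply,
    Equiv.subRight_symm_apply]

theorem SCA_add (m : ℕ) (lam a b : ℤ →₀ ZMod m) :
    SCA m lam (a + b) = SCA m lam a + SCA m lam b := by
  ext n
  simp [SCA_apply, mul_add, Finset.sum_add_distrib]

noncomputable def SCAhom (m : ℕ) (lam : ℤ →₀ ZMod m) : (ℤ →₀ ZMod m) →+ (ℤ →₀ ZMod m) :=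
  AddMonoidHom.mk' (SCA m lam) (SCA_add m lam)

/-- functions supported in `[A,B]` -/
noncomputable abbrev Win (m : ℕ) (A B : ℤ) : Submodule (ZMod m) (ℤ →₀ ZMod m) :=
  Finsupp.supported (ZMod m) (ZMod m) (Set.Icc A B)

theorem mem_Win {m : ℕ} {A B : ℤ} {a : ℤ →₀ ZMod m} :
    a ∈ Win m A B ↔ ∀ n, ¬ (A ≤ n ∧ n ≤ B) → a n = 0 := by
  rw [Win, Finsupp.mem_supported']
  rfl

theorem Win_card (m : ℕ) (A B : ℤ) : Nat.card (Win m A B) = m ^ (B + 1 - A).toNat := by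
  rw [Nat.card_congr (Finsupp.supportedEquivFinsupp (R := ZMod m) (M := ZMod m)
    (Set.Icc A B)).toEquiv, Nat.card_congr Finsupp.equivFunOnFinite, Nat.card_fun]
  simp

theorem Win_finite (m : ℕ) (hm : 1 ≤ m) (A B : ℤ) : (Win m A B : Set (ℤ →₀ ZMod m)).Finite := by
  have h := Win_card m A B
  have : Nat.card (Win m A B) ≠ 0 := by
    rw [h]; positivity
  have := Nat.finite_of_card_ne_zero this
  exact Set.toFinite _

open scoped Pointwise in
theorem Traj_succ' {G : Type*} [AddCommGroup G] (φ : G →+ G) (F : Set G) (n : ℕ) :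
    Traj φ F (n + 1) = F + φ '' Traj φ F n := by
  induction n with
  | zero => simp [Traj]
  | succ n ih =>
    have e1 : Traj φ F (n + 1 + 1) = Traj φ F (n + 1) + φ^[n+1] '' F := rfl
    have e2 : Traj φ F (n + 1) = Traj φ F n + φ^[n] '' F := rfl
    rw [e1]
    conv_lhs => rw [ih]
    rw [e2, Set.image_add, add_assoc, Function.iterate_succ', Set.image_comp]

theorem SCA_mem_Win (m : ℕ) (lam : ℤ →₀ ZMod m) (d A B : ℤ)
    (h0 : ∀ i ∈ lam.support, -d ≤ i ∧ i ≤ 0) {a : ℤ →₀ ZMod m} (ha : a ∈ Win m A B) :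
    SCA m lam a ∈ Win m A (B + d) := by
  rw [mem_Win] at *
  intro n hn
  rw [SCA_apply]
  apply Finset.sum_eq_zero
  intro i hi
  have := h0 i hi
  rw [ha _ (by omega), mul_zero]

theorem Win_mono {m : ℕ} {A B B' : ℤ} (h : B ≤ B') : Win m A B ≤ Win m A B' :=
  Finsupp.supported_mono (Set.Icc_subset_Icc le_rfl h)

open scoped Pointwise in
theorem Traj_sub (m : ℕ) (lam : ℤ →₀ ZMod m) (d A B : ℤ) (hd : 0 ≤ d)
    (h0 : ∀ i ∈ lam.support, -d ≤ i ∧ i ≤ 0) (F : Set (ℤ →₀ ZMod m))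
    (hF : F ⊆ Win m A B) (n : ℕ) :
    Traj (SCA m lam) F n ⊆ Win m A (B + n * d) := by
  induction n with
  | zero => simp [Traj]
  | succ n ih =>
    have := Traj_succ' (SCAhom m lam) F n
    change Traj (SCA m lam) F (n+1) = F + SCA m lam '' Traj (SCA m lam) F n at this
    rw [this]
    rintro _ ⟨f, hf, _, ⟨t, ht, rfl⟩, rfl⟩
    refine (Win m A _).add_mem (Win_mono ?_ (hF hf)) (Win_mono ?_ (SCA_mem_Win m lam d A _ h0 (ih ht)))
    · have : 0 ≤ ((n+1 : ℕ) : ℤ) * d := by positivity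
      linarith
    · push_cast; linarith

theorem SCA_inj (m : ℕ) (lam : ℤ →₀ ZMod m) (d B : ℤ) 
    (h0 : ∀ i ∈ lam.support, -d ≤ i ∧ i ≤ 0) (hu : IsUnit (lam (-d)))
    (t : ℤ →₀ ZMod m) (ht : t ∈ Win m 0 B) (hs : SCA m lam t ∈ Win m 0 (d-1)) : t = 0 := by
  by_contra hne
  have hN := Finset.max'_mem _ (Finsupp.support_nonempty_iff.mpr hne)
  set N := t.support.max' (Finsupp.support_nonempty_iff.mpr hne) with hNdef
  have hmax : ∀ j, N < j → t j = 0 := by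
    intro j hj
    by_contra h
    have := Finset.le_max' t.support j (by simpa using h)
    omega
  have hN0 : t N ≠ 0 := by simpa using hN
  have hNn : 0 ≤ N := by
    by_contra h
    exact hN0 (mem_Win.mp ht N (by omega))
  have h1 : SCA m lam t (N + d) = lam (-d) * t N := by
    rw [SCA_apply, Finset.sum_eq_single (-d)]
    · congr 2; ring
    · intro i hi hne
      have := h0 i hi
      rw [hmax _ (by omega), mul_zero]
    · intro h
      simp only [Finsupp.mem_support_iff, not_not] at h
      simp [h]
  rw [mem_Win.mp hs (N+d) (by omega)] at h1
  exact hN0 ((hu.mul_right_eq_zero).mp h1.symm)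

open scoped Pointwise in
theorem Traj_card (m : ℕ) (hm : 1 ≤ m) (lam : ℤ →₀ ZMod m) (d : ℕ)
    (h0 : ∀ i ∈ lam.support, -(d:ℤ) ≤ i ∧ i ≤ 0) (hu : IsUnit (lam (-(d:ℤ)))) (n : ℕ) :
    Nat.card (Traj (SCA m lam) (Win m 0 ((d:ℤ)-1) : Set (ℤ →₀ ZMod m)) n) = m ^ (n * d) := by
  induction n with
  | zero => simp [Traj]
  | succ n ih =>
    set F : Set (ℤ →₀ ZMod m) := (Win m 0 ((d:ℤ)-1) : Set (ℤ →₀ ZMod m)) with hF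
    have := Traj_succ' (SCAhom m lam) F n
    change Traj (SCA m lam) F (n+1) = F + SCA m lam '' Traj (SCA m lam) F n at this
    have h2 : Traj (SCA m lam) F (n+1) =
        (fun p : (ℤ →₀ ZMod m) × (ℤ →₀ ZMod m) => p.1 + SCA m lam p.2) ''
          (F ×ˢ Traj (SCA m lam) F n) := by
      rw [this]
      ext x
      simp [Set.mem_add]
      try grind
    have hsub := Traj_sub m lam d 0 (d-1) (by positivity) h0 F subset_rfl n
    rw [h2, Nat.card_image_of_injOn, Nat.card_congr (Equiv.Set.prod _ _), Nat.card_prod, ih]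
    · have : Nat.card F = m ^ d := by
        have := Win_card m 0 ((d:ℤ)-1)
        rw [show ((d:ℤ) - 1 + 1 - 0).toNat = d by omega] at this
        exact this
      rw [this]; ring
    · rintro ⟨f, t⟩ ⟨hf, ht⟩ ⟨f', t'⟩ ⟨hf', ht'⟩ heq
      simp only at *
      have e : SCA m lam (t - t') = f' - f := by
        have e1 : SCA m lam (t - t') = SCA m lam t - SCA m lam t' := map_sub (SCAhom m lam) t t'
        rw [e1, sub_eq_sub_iff_add_eq_add, add_comm, heq, add_comm]
        try abel
      have e2 := SCA_inj m lam d _ h0 hu (t - t') (sub_mem (hsub ht) (hsub ht'))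
        (by rw [e]; exact sub_mem hf' hf)
      have e3 : t = t' := sub_eq_zero.mp e2
      subst e3
      simp at heq
      simp [heq]

theorem main_aux (m : ℕ) (hm : 1 ≤ m) (lam : ℤ →₀ ZMod m) (d : ℕ)
    (h0 : ∀ i ∈ lam.support, -(d:ℤ) ≤ i ∧ i ≤ 0) (hu : IsUnit (lam (-(d:ℤ)))) :
    algEntropy (SCA m lam) = ENNReal.ofReal (d * Real.log m) := by
  have hlog : 0 ≤ Real.log m := Real.log_natCast_nonneg m
  apply le_antisymm
  · refine iSup_le fun F => iSup_le fun hfin => iSup_le fun hne => ?_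
    obtain ⟨B, hB, hFB⟩ : ∃ B : ℕ, True ∧ F ⊆ Win m (-B) B := by
      refine ⟨hfin.toFinset.sup fun f => f.support.sup Int.natAbs, trivial, fun f hf => ?_⟩
      rw [SetLike.mem_coe, mem_Win]
      intro n hn
      by_contra h
      have h1 : n.natAbs ≤ f.support.sup Int.natAbs :=
        Finset.le_sup (f := Int.natAbs) (by simpa using h)
      have h2 := Finset.le_sup (f := fun f : ℤ →₀ ZMod m => f.support.sup Int.natAbs)
        (hfin.mem_toFinset.mpr hf)
      have h3 := h1.trans h2
      omega
    have hb : ∀ n : ℕ, 1 ≤ n → Real.log (Nat.card (Traj (SCA m lam) F n)) / n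
        ≤ ((2*B+1) * Real.log m) / n + d * Real.log m := by
      intro n hn
      have hsub := Traj_sub m lam d (-B) B (by positivity) h0 F hFB n
      have hc := Nat.card_mono (Win_finite m hm _ _) hsub
      have hc2 := hc.trans_eq (Win_card m _ _)
      have e : ((B:ℤ) + n * d + 1 - -B).toNat = 2 * B + 1 + n * d := by
        have : ((B:ℤ) + n * d + 1 - -B) = ((2 * B + 1 + n * d : ℕ) : ℤ) := by push_cast; ring
        rw [this, Int.toNat_natCast]
      rw [e] at hc2
      have hn' : (0:ℝ) < n := by exact_mod_cast hn
      have hl : Real.log (Nat.card (Traj (SCA m lam) F n)) ≤ (2 * B + 1 + n * d) * Real.log m := by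
        rcases Nat.eq_zero_or_pos (Nat.card (Traj (SCA m lam) F n)) with h | h
        · rw [h]; simp; positivity
        · have := Real.log_le_log (by exact_mod_cast h) (Nat.cast_le (α := ℝ).mpr hc2)
          rw [Nat.cast_pow, Real.log_pow] at this
          exact_mod_cast this
      rw [div_le_iff₀ hn']
      refine hl.trans_eq ?_
      field_simp
      try ring
    have ht : Filter.Tendsto (fun n : ℕ => ENNReal.ofReal (((2*B+1) * Real.log m) / n + d * Real.log m))
        Filter.atTop (nhds (ENNReal.ofReal (d * Real.log m))) := by
      apply ENNReal.tendsto_ofReal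
      simpa using (tendsto_const_div_atTop_nhds_zero_nat ((2*B+1) * Real.log m)).add_const (d * Real.log m)
    rw [← ht.limsup_eq]
    refine Filter.limsup_le_limsup ?_
    filter_upwards [Filter.eventually_ge_atTop 1] with n hn
    exact ENNReal.ofReal_le_ofReal (hb n hn)
  · refine le_trans ?_ (le_iSup_of_le (Win m 0 ((d:ℤ)-1) : Set (ℤ →₀ ZMod m))
      (le_iSup_of_le (Win_finite m hm _ _) (le_iSup_of_le ⟨0, zero_mem _⟩ le_rfl)))
    rw [← Filter.limsup_const (f := (Filter.atTop : Filter ℕ)) (ENNReal.ofReal (d * Real.log m))]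
    refine Filter.limsup_le_limsup ?_
    filter_upwards [Filter.eventually_ge_atTop 1] with n hn
    have hn' : (0:ℝ) < n := by exact_mod_cast hn
    rw [Traj_card m hm lam d h0 hu, Nat.cast_pow, Real.log_pow]
    apply le_of_eq
    congr 1
    push_cast
    field_simp

theorem stmt12 (m : ℕ) (hm : 1 ≤ m) (lam : ℤ →₀ ZMod m) (hlam : lam ≠ 0)
    (hr : lam.support.max' (Finsupp.support_nonempty_iff.mpr hlam) ≤ 0)
    (hl : IsUnit (lam (lam.support.min' (Finsupp.support_nonempty_iff.mpr hlam)))) :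
    algEntropy (SCA m lam)
      = ENNReal.ofReal
          ((-((lam.support.min' (Finsupp.support_nonempty_iff.mpr hlam) : ℤ) : ℝ))
            * Real.log m) := by
  have hmin : ∀ i ∈ lam.support, lam.support.min' (Finsupp.support_nonempty_iff.mpr hlam) ≤ i := fun i hi => Finset.min'_le lam.support i hi
  have hmax := fun i hi => (Finset.le_max' lam.support i hi).trans hr
  have hmem := Finset.min'_mem lam.support (Finsupp.support_nonempty_iff.mpr hlam)
  generalize lam.support.min' (Finsupp.support_nonempty_iff.mpr hlam) = l at *
  obtain ⟨d, hd⟩ := Int.eq_ofNat_of_zero_le (a := -l) (by have := hmax l hmem; omega)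
  obtain rfl : l = -(d:ℤ) := by omega
  rw [main_aux m hm lam d (fun i hi => ⟨hmin i hi, hmax i hi⟩) hl]
  simp
end

section
/- Let m ≥ 2 and let σ be the right shift on ℤ →₀ ZMod m, an automorphism whose t-th power (t ∈ ℤ) is the map a ↦ (n ↦ a(n−t)). For n, ℓ ∈ ℤ, there exists a group automorphism ξ of ℤ →₀ ZMod m with σ^n = ξ⁻¹ ∘ σ^ℓ ∘ ξ if and only if |n| = |ℓ|. -/
/-- The `t`-th power of the right shift: `(sigma^t a) n = a (n - t)`. -/
def shiftT (m : ℕ) (t : ℤ) (a : ℤ →₀ ZMod m) : ℤ →₀ ZMod m :=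
  Finsupp.equivMapDomain (Equiv.addRight t) a

theorem shiftT_single (m : ℕ) (t i : ℤ) (x : ZMod m) :
    shiftT m t (Finsupp.single i x) = Finsupp.single (i + t) x := by
  simp [shiftT, Finsupp.equivMapDomain_single]

theorem shiftT_apply (m : ℕ) (t i : ℤ) (a : ℤ →₀ ZMod m) :
    shiftT m t a i = a (i - t) := by
  simp [shiftT, Finsupp.equivMapDomain_apply, sub_eq_add_neg]

/-- The linear functionals invariant under the shift by `t`. -/
def InvFun (m : ℕ) (t : ℤ) : Type :=
  {f : (ℤ →₀ ZMod m) →ₗ[ZMod m] ZMod m // ∀ a, f (shiftT m t a) = f a}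

theorem shiftT_add (m : ℕ) (t : ℤ) (a b : ℤ →₀ ZMod m) :
    shiftT m t (a + b) = shiftT m t a + shiftT m t b := by
  ext i; simp [shiftT_apply]

theorem inv_of_single (m : ℕ) (t : ℤ) (f : (ℤ →₀ ZMod m) →ₗ[ZMod m] ZMod m)
    (h : ∀ i x, f (Finsupp.single (i + t) x) = f (Finsupp.single i x)) (a) :
    f (shiftT m t a) = f a := by
  induction a using Finsupp.induction_linear with
  | zero =>
    congr 1
  | add a b ha hb => rw [shiftT_add, map_add, map_add, ha, hb]
  | single i x => rw [shiftT_single, h]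

theorem card_InvFun (m : ℕ) (t : ℤ) :
    Nat.card (InvFun m t) = Nat.card (ZMod t.natAbs → ZMod m) := by
  symm
  let F : (ZMod t.natAbs → ZMod m) → InvFun m t := fun g =>
    ⟨Finsupp.linearCombination (ZMod m) (fun i : ℤ => g (i : ZMod t.natAbs)), by
      apply inv_of_single
      intro i x
      have : ((t : ℤ) : ZMod t.natAbs) = 0 := by
        rw [ZMod.intCast_zmod_eq_zero_iff_dvd]
        exact Int.natAbs_dvd.2 dvd_rfl
      simp [this]⟩
  apply Nat.card_eq_of_bijective F
  constructor
  · intro g g' h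
    funext z
    obtain ⟨i, rfl⟩ := ZMod.intCast_surjective z
    have h1 := congrArg (fun u : InvFun m t => u.1 (Finsupp.single i 1)) h
    simpa [F] using h1
  · rintro ⟨f, hf⟩
    have hs : ∀ i : ℤ, f (Finsupp.single (i + t) 1) = f (Finsupp.single i 1) := by
      intro i
      rw [← shiftT_single, hf]
    have hp : Function.Periodic (fun i : ℤ => f (Finsupp.single i 1)) t := hs
    have key : ∀ i j : ℤ, (i : ZMod t.natAbs) = j →
        f (Finsupp.single i 1) = f (Finsupp.single j 1) := by
      intro i j hij
      rw [ZMod.intCast_eq_intCast_iff_dvd_sub, Int.natAbs_dvd] at hij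
      obtain ⟨k, hk⟩ := hij
      have := hp.int_mul k i
      have e : j = i + k * t := by linarith
      rw [e]
      exact this.symm
    choose s hs' using ZMod.intCast_surjective (n := t.natAbs)
    refine ⟨fun z => f (Finsupp.single (s z) 1), ?_⟩
    apply Subtype.ext
    apply Finsupp.lhom_ext'
    intro i
    apply LinearMap.ext_ring
    simp only [F, LinearMap.comp_apply, Finsupp.lsingle_apply,
      Finsupp.linearCombination_single, one_smul]
    exact key _ _ (hs' _)

theorem card_inj (m : ℕ) (hm : 2 ≤ m) (k l : ℕ)
    (h : Nat.card (ZMod k → ZMod m) = Nat.card (ZMod l → ZMod m)) : k = l := by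
  have : NeZero m := ⟨by omega⟩
  have : Fact (1 < m) := ⟨by omega⟩
  have h0 : Nat.card (ZMod 0 → ZMod m) = 0 := by
    have : Infinite (ZMod 0) := inferInstanceAs (Infinite ℤ)
    exact Nat.card_eq_zero_of_infinite
  have hk : ∀ k : ℕ, Nat.card (ZMod (k + 1) → ZMod m) = m ^ (k + 1) := by
    intro k
    rw [Nat.card_fun, Nat.card_zmod, Nat.card_zmod]
  have hpos : ∀ k : ℕ, m ^ (k + 1) ≠ 0 := fun k => pow_ne_zero _ (by omega)
  rcases k with _ | k <;> rcases l with _ | l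
  · rfl
  · rw [h0, hk] at h; exact absurd h.symm (hpos _)
  · rw [h0, hk] at h; exact absurd h (hpos _)
  · rw [hk, hk] at h
    exact Nat.pow_right_injective hm h

theorem stmt18 (m : ℕ) (hm : 2 ≤ m) (n ℓ : ℤ) :
    (∃ ξ : (ℤ →₀ ZMod m) ≃+ (ℤ →₀ ZMod m),
      ∀ a, shiftT m n a = ξ.symm (shiftT m ℓ (ξ a))) ↔ |n| = |ℓ| := by
  constructor
  · rintro ⟨ξ, h⟩
    have h1 : ∀ a, ξ (shiftT m n a) = shiftT m ℓ (ξ a) := by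
      intro a; rw [h, ξ.apply_symm_apply]
    have h2 : ∀ a, ξ.symm (shiftT m ℓ a) = shiftT m n (ξ.symm a) := by
      intro a; rw [h, ξ.apply_symm_apply]
    let X : (ℤ →₀ ZMod m) →ₗ[ZMod m] (ℤ →₀ ZMod m) :=
      AddMonoidHom.toZModLinearMap m ξ.toAddMonoidHom
    let Y : (ℤ →₀ ZMod m) →ₗ[ZMod m] (ℤ →₀ ZMod m) :=
      AddMonoidHom.toZModLinearMap m ξ.symm.toAddMonoidHom
    have hX : ∀ a, X a = ξ a := fun _ => rfl
    have hY : ∀ a, Y a = ξ.symm a := fun _ => rfl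
    let e : InvFun m ℓ ≃ InvFun m n :=
      { toFun := fun f => ⟨f.1.comp X, fun a => by
          rw [LinearMap.comp_apply, LinearMap.comp_apply, hX, hX, h1, f.2]⟩
        invFun := fun f => ⟨f.1.comp Y, fun a => by
          rw [LinearMap.comp_apply, LinearMap.comp_apply, hY, hY, h2, f.2]⟩
        left_inv := fun f => by
          apply Subtype.ext
          apply LinearMap.ext
          intro a
          simp only [LinearMap.comp_apply, hX, hY, ξ.apply_symm_apply]
        right_inv := fun f => by
          apply Subtype.ext
          apply LinearMap.ext
          intro a
          simp only [LinearMap.comp_apply, hX, hY, ξ.symm_apply_apply] }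
    have hc := Nat.card_congr e
    rw [card_InvFun, card_InvFun] at hc
    have := card_inj m hm _ _ hc
    rw [Int.abs_eq_natAbs, Int.abs_eq_natAbs, this]
  · intro h
    rcases abs_eq_abs.1 h with rfl | rfl
    · exact ⟨AddEquiv.refl _, fun a => rfl⟩
    · refine ⟨Finsupp.domCongr (Equiv.neg ℤ), fun a => ?_⟩
      ext i
      simp [shiftT_apply, Finsupp.domCongr]
      try (congr 1; ring)
end
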